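/- arXiv:2409.18748 — 11 statements merged into one kernel-verified Lean document; each statement's English description precedes it below -/
import Mathlib

section
/- Let $n \ge 2$, let $e \in \mathbb{R}^n$ be the all-ones vector, let $x \in \mathbb{R}^n$ with $x \ne 0$ and $x \notin \mathrm{span}\{e\}$, let $\delta \ne 0$ be a real number, and set $z = e + \delta x$. Consider the $n \times n$ real matrix $G = x z^{\top} + e x^{\top}$ (sum of the two outer products). Then the discriminant $D := \delta^2 \|x\|_2^4 + 4\,(n + \delta \langle e, x\rangle)\,\|x\|_2^2$ is positive, and each of the two real numbers $\lambda_{1,2} = \tfrac{1}{2}\big( (2\langle e, x\rangle + \delta\|x\|_2^2) \pm \sqrt{D} \big)$ is an eigenvalue of $G$, i.e., there exists a nonzero $v \in \mathbb{R}^n$ with $G v = \lambda v$. -/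
/-- Strict Cauchy-Schwarz inequality against the all-ones vector. -/
theorem sq_sum_lt_card_mul_sum_sq {n : ℕ} (hn : 0 < n) {x : Fin n → ℝ}
    (hx : x ∉ Submodule.span ℝ {(fun _ => (1:ℝ) : Fin n → ℝ)}) :
    (∑ i, x i) ^ 2 < n * ∑ i, (x i) ^ 2 := by
  have hn' : (0 : ℝ) < n := Nat.cast_pos.mpr hn
  have hsum : ∑ i, (n * x i - ∑ j, x j) ^ 2
      = n * (n * ∑ i, (x i) ^ 2 - (∑ i, x i) ^ 2) := by
    simp only [sub_sq, mul_pow, Finset.sum_add_distrib, Finset.sum_sub_distrib,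
      ← Finset.mul_sum, ← Finset.sum_mul, Finset.sum_const, Finset.card_univ,
      Fintype.card_fin, nsmul_eq_mul, mul_assoc]
    ring
  by_contra! hle
  have hzero : ∑ i, (n * x i - ∑ j, x j) ^ 2 = 0 :=
    le_antisymm (hsum ▸ mul_nonpos_of_nonneg_of_nonpos hn'.le (sub_nonpos.mpr hle))
      (Finset.sum_nonneg fun i _ => sq_nonneg _)
  rw [Finset.sum_eq_zero_iff_of_nonneg fun i _ => sq_nonneg _] at hzero
  refine hx (Submodule.mem_span_singleton.mpr ⟨(∑ j, x j) / n, funext fun i => ?_⟩)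
  have hi := pow_eq_zero_iff two_ne_zero |>.mp (hzero i (Finset.mem_univ i))
  simp only [Pi.smul_apply, smul_eq_mul, mul_one]
  rw [div_eq_iff hn'.ne']
  linarith

/-- If `μ` solves the reduced characteristic equation, then `⟨e, x⟩ + μ` is an eigenvalue of
`x zᵀ + e xᵀ` with `z = e + δ x` and `e` the all-ones vector. -/
theorem exists_eigenvector_outer_sum {n : ℕ} (hn : 0 < n) {x : Fin n → ℝ} (hx : x ≠ 0)
    (hxe : x ∉ Submodule.span ℝ {(fun _ => (1:ℝ) : Fin n → ℝ)}) {δ μ : ℝ}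
    (hμ : μ * (μ - δ * ∑ i, (x i) ^ 2) = (∑ i, (x i) ^ 2) * (n + δ * ∑ i, x i)) :
    ∃ v : Fin n → ℝ, v ≠ 0 ∧
      Matrix.mulVec (fun i j => x i * (1 + δ * x j) + x j) v = (∑ i, x i + μ) • v := by
  have hS : ∑ i, (x i) ^ 2 ≠ 0 := fun h => hx <| funext fun i => by
    rw [Finset.sum_eq_zero_iff_of_nonneg fun i _ => sq_nonneg _] at h
    exact pow_eq_zero_iff two_ne_zero |>.mp (h i (Finset.mem_univ i))
  refine ⟨fun i => μ * x i + ∑ j, (x j) ^ 2, fun hv => ?_, funext fun i => ?_⟩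
  · have hv' (i : Fin n) : μ * x i + ∑ j, (x j) ^ 2 = 0 := congrFun hv i
    have hμ0 : μ ≠ 0 := by
      rintro rfl
      exact hS (by simpa using hv' ⟨0, hn⟩)
    refine hxe (Submodule.mem_span_singleton.mpr
      ⟨-(∑ j, (x j) ^ 2) / μ, funext fun i => ?_⟩)
    simp only [Pi.smul_apply, smul_eq_mul, mul_one]
    rw [div_eq_iff hμ0]
    linarith [hv' i]
  · simp only [Matrix.mulVec, dotProduct, Pi.smul_apply, smul_eq_mul]
    generalize hT : ∑ j, (x j) ^ 2 = S at *
    have hsum : ∑ j, (x i * (1 + δ * x j) + x j) * (μ * x j + S)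
        = (x i * δ + 1) * μ * S + (x i * μ + x i * δ * S + S) * ∑ j, x j + n * (x i * S) := by
      have hterm (j : Fin n) : (x i * (1 + δ * x j) + x j) * (μ * x j + S)
          = (x i * δ + 1) * μ * (x j) ^ 2 + (x i * μ + x i * δ * S + S) * x j + x i * S := by
        ring
      simp only [hterm, Finset.sum_add_distrib, ← Finset.mul_sum, hT, Finset.sum_const,
        Finset.card_univ, Fintype.card_fin, nsmul_eq_mul]
      ring
    rw [hsum]
    linear_combination -(x i) * hμ

theorem eigenvalues_of_outer_sum (n : ℕ) (hn : 2 ≤ n) (x : Fin n → ℝ)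
    (hx : x ≠ 0) (hxe : x ∉ Submodule.span ℝ {(fun _ => (1:ℝ) : Fin n → ℝ)})
    (δ : ℝ) (hδ : δ ≠ 0)
    (e : Fin n → ℝ) (he : e = fun _ => (1:ℝ))
    (z : Fin n → ℝ) (hz : z = e + δ • x)
    (G : Matrix (Fin n) (Fin n) ℝ) (hG : G = fun i j => x i * z j + e i * x j)
    (D : ℝ) (hD : D = δ ^ 2 * (∑ i, (x i) ^ 2) ^ 2 +
      4 * ((n : ℝ) + δ * ∑ i, e i * x i) * ∑ i, (x i) ^ 2) :
    0 < D ∧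
    (∃ v : Fin n → ℝ, v ≠ 0 ∧
      G.mulVec v = (((2 * ∑ i, e i * x i + δ * ∑ i, (x i) ^ 2) + Real.sqrt D) / 2) • v) ∧
    (∃ v : Fin n → ℝ, v ≠ 0 ∧
      G.mulVec v = (((2 * ∑ i, e i * x i + δ * ∑ i, (x i) ^ 2) - Real.sqrt D) / 2) • v) := by
  have hn0 : 0 < n := by omega
  subst he hz hG
  simp only [one_mul] at hD ⊢
  have hS : 0 ≤ ∑ i, (x i) ^ 2 := Finset.sum_nonneg fun i _ => sq_nonneg _
  have hpos : 0 < D := by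
    have hlt := sq_sum_lt_card_mul_sum_sq hn0 hxe
    nlinarith [sq_nonneg (δ * ∑ i, (x i) ^ 2 + 2 * ∑ i, x i)]
  have hsq := Real.sq_sqrt hpos.le
  refine ⟨hpos, ?_, ?_⟩
  · obtain ⟨v, hv, h⟩ := exists_eigenvector_outer_sum hn0 hx hxe (δ := δ)
      (μ := (δ * ∑ i, (x i) ^ 2 + Real.sqrt D) / 2) (by linear_combination (hsq + hD) / 4)
    refine ⟨v, hv, h.trans ?_⟩
    congr 1
    ring
  · obtain ⟨v, hv, h⟩ := exists_eigenvector_outer_sum hn0 hx hxe (δ := δ)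
      (μ := (δ * ∑ i, (x i) ^ 2 - Real.sqrt D) / 2) (by linear_combination (hsq + hD) / 4)
    refine ⟨v, hv, h.trans ?_⟩
    congr 1
    ring
end

section
/- Let $A$ be a real $m \times n$ matrix and $b \in \mathbb{R}^m$ with $b \ne 0$. Suppose $x \in \mathbb{R}^n$ is a local minimizer of the function $y \mapsto \|y\|_1 / \|y\|_2$ on the affine set $\mathcal{H} = \{y \in \mathbb{R}^n : A y = b\}$. Then: (a) every nonzero vector $v \in \mathbb{R}^n$ whose support is contained in $\mathrm{supp}(x) = \{i : x_i \ne 0\}$ satisfies $A v \ne 0$ (the columns of $A$ indexed by $\mathrm{supp}(x)$ are linearly independent); and (b) for every real $\sigma \ge 0$ such that $\|A v\|_2^2 \ge \sigma \|v\|_2^2$ for all $v$ supported on $\mathrm{supp}(x)$, one has $\sigma \|x\|_2^2 \le \|b\|_2^2$. -/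
open Filter Topology in
/-- Near a nonzero `a` the absolute value is affine with slope `SignType.sign a`. -/
theorem eventually_abs_add_mul (a v : ℝ) (h : a = 0 → v = 0) :
    ∀ᶠ t in 𝓝 (0 : ℝ), |a + t * v| = |a| + t * (SignType.sign a * v) := by
  have hc : Tendsto (fun t : ℝ => a + t * v) (𝓝 0) (𝓝 a) :=
    Continuous.tendsto' (by fun_prop) _ _ (by simp)
  rcases lt_trichotomy a 0 with ha | ha | ha
  · filter_upwards [hc.eventually_lt_const ha] with t ht
    rw [abs_of_neg ht, abs_of_neg ha, sign_neg ha, SignType.coe_neg_one]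
    ring
  · simp [ha, h ha]
  · filter_upwards [hc.eventually_const_lt ha] with t ht
    rw [abs_of_pos ht, abs_of_pos ha, sign_pos ha, SignType.coe_one]
    ring

/-- Cross-multiplied, squared form of an inequality between quotients by square roots. -/
theorem sq_mul_le_sq_mul_of_div_sqrt_le {a c p P : ℝ} (ha : 0 ≤ a) (hp : 0 < p) (hP : 0 < P)
    (h : a / √p ≤ c / √P) : a ^ 2 * P ≤ c ^ 2 * p := by
  rw [div_le_div_iff₀ (Real.sqrt_pos.2 hp) (Real.sqrt_pos.2 hP)] at h
  have h2 := pow_le_pow_left₀ (by positivity) h 2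
  rwa [mul_pow, mul_pow, Real.sq_sqrt hP.le, Real.sq_sqrt hp.le] at h2

open Filter Topology in
/-- First and second order conditions for a quadratic that is nonnegative near its root `0`. -/
theorem coeff_of_eventually_nonneg {L M : ℝ} (h : ∀ᶠ t in 𝓝 (0 : ℝ), 0 ≤ L * t + M * t ^ 2) :
    L = 0 ∧ 0 ≤ M := by
  have hL : L = 0 := by
    have hmin : IsLocalMin (fun t : ℝ => L * t + M * t ^ 2) 0 := by
      filter_upwards [h] with t ht
      simpa using ht
    have hd : HasDerivAt (fun t : ℝ => L * t + M * t ^ 2) L 0 := by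
      simpa using ((hasDerivAt_id (0 : ℝ)).const_mul L).fun_add
        (((hasDerivAt_id (0 : ℝ)).pow 2).const_mul M)
    exact hmin.hasDerivAt_eq_zero hd
  refine ⟨hL, ?_⟩
  obtain ⟨t, ht, ht0⟩ := ((h.filter_mono nhdsWithin_le_nhds).and
    (self_mem_nhdsWithin : Set.Ioi (0 : ℝ) ∈ 𝓝[>] 0)).exists
  have : 0 < t ^ 2 := pow_pos ht0 2
  rw [hL, zero_mul, zero_add] at ht
  exact nonneg_of_mul_nonneg_left ht this

open Filter Topology in
/-- If the ratio of the `ℓ¹` and `ℓ²` norms has a local minimum at `x` along the line through `x`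
with direction `v`, where `v` is supported on the support of `x`, then `v` is parallel to `x`. -/
theorem parallel_of_isLocalMin_line {ι : Type*} [Fintype ι] {x v : ι → ℝ} (hx : x ≠ 0)
    (hv : ∀ i, x i = 0 → v i = 0)
    (h : ∀ᶠ t in 𝓝 (0 : ℝ), (∑ i, |x i|) / √(∑ i, x i ^ 2) ≤
      (∑ i, |x i + t * v i|) / √(∑ i, (x i + t * v i) ^ 2)) (i : ι) :
    (∑ j, x j ^ 2) * v i = (∑ j, x j * v j) * x i := by
  obtain ⟨j, hj⟩ := Function.ne_iff.1 hx
  set α := ∑ i, |x i| with hα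
  set β := ∑ i, SignType.sign (x i) * v i with hβ
  set p := ∑ i, x i ^ 2 with hp
  set q := ∑ i, x i * v i with hq
  set r := ∑ i, v i ^ 2 with hr
  have hαpos : 0 < α :=
    Finset.sum_pos' (fun i _ => abs_nonneg _) ⟨j, Finset.mem_univ j, abs_pos.2 hj⟩
  have hppos : 0 < p :=
    Finset.sum_pos' (fun i _ => sq_nonneg _) ⟨j, Finset.mem_univ j, sq_pos_iff.2 hj⟩
  have hP (t : ℝ) : ∑ i, (x i + t * v i) ^ 2 = p + 2 * t * q + t ^ 2 * r := by
    simp only [hp, hq, hr, Finset.mul_sum, ← Finset.sum_add_distrib]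
    exact Finset.sum_congr rfl fun i _ => by ring
  have habs : ∀ᶠ t in 𝓝 (0 : ℝ), ∑ i, |x i + t * v i| = α + t * β := by
    filter_upwards [eventually_all.2 fun i => eventually_abs_add_mul (x i) (v i) (hv i)] with t ht
    simp only [ht, Finset.sum_add_distrib, ← Finset.mul_sum, hα, hβ]
  have hpos : ∀ᶠ t in 𝓝 (0 : ℝ), 0 < p + 2 * t * q + t ^ 2 * r :=
    (Continuous.tendsto' (by fun_prop) _ _ (by simp)).eventually_const_lt hppos
  obtain ⟨hL, hM⟩ := coeff_of_eventually_nonneg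
    (L := 2 * α * (p * β - α * q)) (M := p * β ^ 2 - α ^ 2 * r) (by
      filter_upwards [h, habs, hpos] with t ht hta htp
      rw [hta, hP] at ht
      linarith [sq_mul_le_sq_mul_of_div_sqrt_le hαpos.le hppos htp ht])
  have hcrit : p * β = α * q := by
    rcases mul_eq_zero.1 hL with h0 | h0
    · linarith
    · exact sub_eq_zero.1 h0
  have hCS : p * r ≤ q ^ 2 := by
    have h1 : 0 ≤ α ^ 2 * (q ^ 2 - p * r) := by
      have := mul_nonneg hppos.le hM
      linear_combination this + (p * β + α * q) * hcrit
    linarith [nonneg_of_mul_nonneg_right h1 (by positivity)]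
  have hsum : ∑ i, (p * v i - q * x i) ^ 2 = p * (p * r - q ^ 2) := by
    have hexp (a c : ℝ) :
        ∑ i, (a * v i - c * x i) ^ 2 = a ^ 2 * r - 2 * a * c * q + c ^ 2 * p := by
      simp only [hp, hq, hr, Finset.mul_sum, ← Finset.sum_add_distrib, ← Finset.sum_sub_distrib]
      exact Finset.sum_congr rfl fun i _ => by ring
    rw [hexp]
    ring
  have hzero : ∑ i, (p * v i - q * x i) ^ 2 = 0 :=
    le_antisymm (hsum ▸ mul_nonpos_of_nonneg_of_nonpos hppos.le (by linarith))
      (Finset.sum_nonneg fun i _ => sq_nonneg _)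
  have := (Finset.sum_eq_zero_iff_of_nonneg fun i _ => sq_nonneg _).1 hzero i (Finset.mem_univ i)
  exact sub_eq_zero.1 (pow_eq_zero_iff two_ne_zero |>.1 this)


theorem constrained_local_min_bound (m n : ℕ) (A : Matrix (Fin m) (Fin n) ℝ)
    (b : Fin m → ℝ) (hb : b ≠ 0) (x : Fin n → ℝ)
    (hxH : A.mulVec x = b)
    (hloc : IsLocalMinOn
      (fun y : Fin n → ℝ => (∑ i, |y i|) / Real.sqrt (∑ i, (y i) ^ 2))
      {y : Fin n → ℝ | A.mulVec y = b} x) :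
    (∀ v : Fin n → ℝ, v ≠ 0 → (∀ i, x i = 0 → v i = 0) → A.mulVec v ≠ 0) ∧
    (∀ σ : ℝ, 0 ≤ σ →
      (∀ v : Fin n → ℝ, (∀ i, x i = 0 → v i = 0) →
        σ * ∑ i, (v i) ^ 2 ≤ ∑ k, (A.mulVec v k) ^ 2) →
      σ * ∑ i, (x i) ^ 2 ≤ ∑ k, (b k) ^ 2) := by
  refine ⟨fun v hv0 hv hAv => hv0 ?_, fun σ _ h => hxH ▸ h x fun _ => id⟩
  have hx : x ≠ 0 := by
    rintro rfl
    exact hb (by rw [← hxH, Matrix.mulVec_zero])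
  have hline : Filter.Tendsto (fun t : ℝ => x + t • v) (nhds 0)
      (nhdsWithin x {y | A.mulVec y = b}) :=
    tendsto_nhdsWithin_iff.2 ⟨Continuous.tendsto' (by fun_prop) _ _ (by simp),
      Filter.Eventually.of_forall fun t => by
        simp [Matrix.mulVec_add, Matrix.mulVec_smul, hAv, hxH]⟩
  have hpar : (∑ j, x j ^ 2) • v = (∑ j, x j * v j) • x :=
    funext fun i => parallel_of_isLocalMin_line hx hv (hline.eventually hloc) i
  have hq : ∑ j, x j * v j = 0 := by
    have := congrArg A.mulVec hpar
    rw [Matrix.mulVec_smul, Matrix.mulVec_smul, hAv, hxH, smul_zero] at this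
    exact (smul_eq_zero.1 this.symm).resolve_right hb
  rw [hq, zero_smul] at hpar
  refine (smul_eq_zero.1 hpar).resolve_left fun hp => hx (funext fun i => ?_)
  have := (Finset.sum_eq_zero_iff_of_nonneg fun i _ => sq_nonneg _).1 hp i (Finset.mem_univ i)
  exact pow_eq_zero_iff two_ne_zero |>.1 this
end

section
/- Let $A$ be a real $m \times n$ matrix, $b \in \mathbb{R}^m$ with $b \ne 0$, and $\gamma > 0$. Suppose $x \ne 0$ is a local minimizer of $F(y) = \gamma \|y\|_1/\|y\|_2 + \tfrac12 \|A y - b\|_2^2$ on $\mathbb{R}^n \setminus \{0\}$, and let $\Lambda = \mathrm{supp}(x)$. Assume $\sigma > 0$ is a real number such that $\|A v\|_2^2 \ge \sigma \|v\|_2^2$ for every $v \in \mathbb{R}^n$ supported on $\Lambda$. Then $\|x\|_2 \le \tfrac{1}{2}\Big( \sigma^{-1}\|A^{\top} b\|_2 + \sqrt{(\sigma^{-1}\|A^{\top} b\|_2)^2 + 4 \sigma^{-1} \gamma \sqrt{n}} \Big)$. -/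
open Filter Topology in
/-- A local minimizer on the nonzero vectors of a scale-invariant function plus a least-squares
term has a residual orthogonal to its image under `A`. -/
theorem dotProduct_residual_eq_zero_of_isLocalMinOn {ι κ : Type*} [Fintype ι] [Fintype κ]
    {A : Matrix κ ι ℝ} {b : κ → ℝ} {R : (ι → ℝ) → ℝ} {x : ι → ℝ} (hx : x ≠ 0)
    (hR : ∀ t : ℝ, 0 < t → R (t • x) = R x)
    (hloc : IsLocalMinOn (fun y => R y + (1 / 2) * ∑ k, (A.mulVec y k - b k) ^ 2)
      {y | y ≠ 0} x) :
    ∑ k, (A.mulVec x k - b k) * A.mulVec x k = 0 := by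
  have hpos : ∀ᶠ t : ℝ in 𝓝 1, 0 < t := lt_mem_nhds one_pos
  have hray : Tendsto (fun t : ℝ => t • x) (𝓝 1) (𝓝[{y | y ≠ 0}] x) := by
    refine tendsto_nhdsWithin_iff.2 ⟨?_, ?_⟩
    · have h : ContinuousAt (fun t : ℝ => t • x) 1 := by fun_prop
      simpa [ContinuousAt] using h
    · filter_upwards [hpos] with t ht
      exact smul_ne_zero ht.ne' hx
  have hmin : IsLocalMin (fun t : ℝ => (1 / 2) * ∑ k, (t * A.mulVec x k - b k) ^ 2) 1 := by
    filter_upwards [hray.eventually hloc, hpos] with t ht ht0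
    simpa [hR t ht0, Matrix.mulVec_smul] using ht
  have hderiv : HasDerivAt (fun t : ℝ => (1 / 2) * ∑ k, (t * A.mulVec x k - b k) ^ 2)
      ((1 / 2) * ∑ k, 2 * (1 * A.mulVec x k - b k) * A.mulVec x k) 1 := by
    refine HasDerivAt.const_mul _ (HasDerivAt.fun_sum fun k _ => ?_)
    simpa using (((hasDerivAt_id (1 : ℝ)).mul_const (A.mulVec x k)).sub_const (b k)).fun_pow 2
  have hzero := hmin.hasDerivAt_eq_zero hderiv
  simpa [mul_assoc, ← Finset.mul_sum] using hzero

/-- The ratio of the `ℓ¹` norm to the `ℓ²` norm is invariant under positive scaling. -/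
theorem sum_abs_div_sqrt_sum_sq_smul {ι : Type*} [Fintype ι] (x : ι → ℝ) {t : ℝ} (ht : 0 < t) :
    (∑ i, |(t • x) i|) / Real.sqrt (∑ i, ((t • x) i) ^ 2) =
      (∑ i, |x i|) / Real.sqrt (∑ i, (x i) ^ 2) := by
  simp only [Pi.smul_apply, smul_eq_mul, abs_mul, mul_pow, ← Finset.mul_sum, abs_of_pos ht]
  rw [Real.sqrt_mul (sq_nonneg t), Real.sqrt_sq ht.le, mul_div_mul_left _ _ ht.ne']


theorem unconstrained_local_min_norm_bound (m n : ℕ) (A : Matrix (Fin m) (Fin n) ℝ)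
    (b : Fin m → ℝ) (hb : b ≠ 0) (γ : ℝ) (hγ : 0 < γ)
    (x : Fin n → ℝ) (hx : x ≠ 0)
    (hloc : IsLocalMinOn
      (fun y : Fin n → ℝ =>
        γ * ((∑ i, |y i|) / Real.sqrt (∑ i, (y i) ^ 2)) +
          (1 / 2) * ∑ k, (A.mulVec y k - b k) ^ 2)
      {y : Fin n → ℝ | y ≠ 0} x)
    (σ : ℝ) (hσ : 0 < σ)
    (hσA : ∀ v : Fin n → ℝ, (∀ i, x i = 0 → v i = 0) →
      σ * ∑ i, (v i) ^ 2 ≤ ∑ k, (A.mulVec v k) ^ 2) :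
    Real.sqrt (∑ i, (x i) ^ 2) ≤
      (σ⁻¹ * Real.sqrt (∑ i, (A.transpose.mulVec b i) ^ 2) +
        Real.sqrt ((σ⁻¹ * Real.sqrt (∑ i, (A.transpose.mulVec b i) ^ 2)) ^ 2 +
          4 * σ⁻¹ * γ * Real.sqrt n)) / 2 := by
  have horth := dotProduct_residual_eq_zero_of_isLocalMinOn
    (R := fun y => γ * ((∑ i, |y i|) / Real.sqrt (∑ i, (y i) ^ 2))) hx
    (fun t ht => by simp only [sum_abs_div_sqrt_sum_sq_smul x ht]) hloc
  have hnormal : ∑ k, (A.mulVec x k) ^ 2 = ∑ i, A.transpose.mulVec b i * x i := by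
    have hadj : ∑ k, b k * A.mulVec x k = ∑ i, A.transpose.mulVec b i * x i := by
      have h := Matrix.dotProduct_mulVec b A x
      rwa [← Matrix.mulVec_transpose] at h
    rw [← hadj, ← sub_eq_zero, ← Finset.sum_sub_distrib, ← horth]
    exact Finset.sum_congr rfl fun k _ => by ring
  have hcs := Real.sum_mul_le_sqrt_mul_sqrt Finset.univ (A.transpose.mulVec b) x
  have hcoer := hσA x fun _ h => h
  have hsum : 0 < ∑ i, (x i) ^ 2 := by
    obtain ⟨i, hi⟩ := Function.ne_iff.1 hx
    exact Finset.sum_pos' (fun i _ => sq_nonneg _) ⟨i, Finset.mem_univ i, sq_pos_of_ne_zero hi⟩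
  have hsq := Real.sq_sqrt hsum.le
  have hpos := Real.sqrt_pos.2 hsum
  set r := Real.sqrt (∑ i, (x i) ^ 2)
  set β := Real.sqrt (∑ i, (A.transpose.mulVec b i) ^ 2)
  have hr : r ≤ σ⁻¹ * β := by
    rw [le_inv_mul_iff₀ hσ]
    refine le_of_mul_le_mul_right ?_ hpos
    calc σ * r * r = σ * ∑ i, (x i) ^ 2 := by rw [← hsq]; ring
      _ ≤ β * r := hcoer.trans (hnormal.trans_le hcs)
  have hroot : σ⁻¹ * β ≤ Real.sqrt ((σ⁻¹ * β) ^ 2 + 4 * σ⁻¹ * γ * Real.sqrt n) :=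
    Real.le_sqrt_of_sq_le (le_add_of_nonneg_right (by positivity))
  linarith
end

section
/- Let $A$ be a real $m \times n$ matrix, $b \in \mathbb{R}^m$, and $\gamma > 0$. Suppose $x \ne 0$ is a local minimizer of $F(y) = \gamma \|y\|_1/\|y\|_2 + \tfrac12 \|A y - b\|_2^2$ on $\mathbb{R}^n \setminus \{0\}$. Set $a = \|x\|_1$ and $r = \|x\|_2$. Then for every index $i$ with $x_i \ne 0$, the first-order optimality condition holds: $\gamma\left( \dfrac{\mathrm{sign}(x_i)}{r} - \dfrac{a\, x_i}{r^3} \right) + \big(A^{\top}(A x - b)\big)_i = 0$. -/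
theorem hasDerivAt_abs_sign {c : ℝ} (hc : c ≠ 0) :
    HasDerivAt (fun s : ℝ => |s|) (Real.sign c) c := by
  rcases hc.lt_or_gt with h | h
  · rw [Real.sign_of_neg h]
    exact hasDerivAt_abs_neg h
  · rw [Real.sign_of_pos h]
    exact hasDerivAt_abs_pos h

theorem unconstrained_first_order_condition (m n : ℕ) (A : Matrix (Fin m) (Fin n) ℝ)
    (b : Fin m → ℝ) (γ : ℝ) (hγ : 0 < γ)
    (x : Fin n → ℝ) (hx : x ≠ 0)
    (hloc : IsLocalMinOn
      (fun y : Fin n → ℝ =>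
        γ * ((∑ i, |y i|) / Real.sqrt (∑ i, (y i) ^ 2)) +
          (1 / 2) * ∑ k, (A.mulVec y k - b k) ^ 2)
      {y : Fin n → ℝ | y ≠ 0} x)
    (a r : ℝ) (ha : a = ∑ i, |x i|) (hr : r = Real.sqrt (∑ i, (x i) ^ 2)) :
    ∀ i, x i ≠ 0 →
      γ * (Real.sign (x i) / r - a * x i / r ^ 3) +
        A.transpose.mulVec (A.mulVec x - b) i = 0 := by
  intro i hi
  have hS : 0 < ∑ j, (x j) ^ 2 :=
    Finset.sum_pos' (fun j _ => sq_nonneg _) ⟨i, Finset.mem_univ i, by positivity⟩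
  have hr0 : 0 < r := hr ▸ Real.sqrt_pos.mpr hS
  have hmin := hloc.isLocalMin (isOpen_ne.mem_nhds hx)
  set e : Fin n → ℝ := Pi.single i 1 with he
  have hline : Continuous fun t : ℝ => x + t • e := by fun_prop
  have hx0 : x + (0 : ℝ) • e = x := by simp
  have hmin_line := IsLocalMin.comp_continuous (b := (0 : ℝ)) (g := fun t : ℝ => x + t • e)
    (by simpa only [hx0] using hmin) hline.continuousAt
  have hcoord (j : Fin n) : HasDerivAt (fun t : ℝ => (x + t • e) j) (e j) 0 := by
    simpa using ((hasDerivAt_id (0 : ℝ)).mul_const (e j)).const_add (x j)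
  have hd_l1 : HasDerivAt (fun t : ℝ => ∑ j, |(x + t • e) j|) (Real.sign (x i)) 0 := by
    have h (j : Fin n) :
        HasDerivAt (fun t : ℝ => |(x + t • e) j|) (Real.sign (x i) * e j) 0 := by
      by_cases hj : j = i
      · subst hj
        refine HasDerivAt.comp (0 : ℝ) (h₂ := fun s : ℝ => |s|) ?_ (hcoord j)
        rw [hx0]
        exact hasDerivAt_abs_sign hi
      · simpa [he, hj] using hasDerivAt_const (0 : ℝ) |x j|
    simpa [he, Pi.single_apply] using HasDerivAt.fun_sum (u := Finset.univ) fun j _ => h j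
  have hd_sq : HasDerivAt (fun t : ℝ => ∑ j, ((x + t • e) j) ^ 2) (2 * x i) 0 := by
    have h := HasDerivAt.fun_sum (u := Finset.univ) fun j _ => (hcoord j).fun_pow 2
    simpa [he, Pi.single_apply] using h
  have hd_l2 : HasDerivAt (fun t : ℝ => Real.sqrt (∑ j, ((x + t • e) j) ^ 2)) (x i / r) 0 := by
    have h := hd_sq.sqrt (by rw [hx0]; exact hS.ne')
    rw [hx0, ← hr] at h
    exact h.congr_deriv (by field_simp)
  have hd_res : HasDerivAt (fun t : ℝ => ∑ k, (A.mulVec (x + t • e) k - b k) ^ 2)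
      (2 * A.transpose.mulVec (A.mulVec x - b) i) 0 := by
    have hk (k : Fin m) : HasDerivAt (fun t : ℝ => A.mulVec (x + t • e) k - b k) (A k i) 0 := by
      have h := (((hasDerivAt_id (0 : ℝ)).mul_const (A k i)).const_add (A.mulVec x k)).sub_const
        (b k)
      simpa [he, Matrix.mulVec_add, Matrix.mulVec_smul] using h
    have h := HasDerivAt.fun_sum (u := Finset.univ) fun k _ => (hk k).fun_pow 2
    refine h.congr_deriv ?_
    rw [hx0]
    simp only [Matrix.mulVec, dotProduct, Matrix.transpose_apply, Pi.sub_apply, Finset.mul_sum]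
    refine Finset.sum_congr rfl fun k _ => ?_
    push_cast
    ring
  have hd := ((hd_l1.fun_div hd_l2 (by rw [hx0, ← hr]; exact hr0.ne')).const_mul γ).fun_add
    (hd_res.const_mul (1 / 2))
  have hzero := hmin_line.hasDerivAt_eq_zero hd
  rw [hx0, ← hr, ← ha] at hzero
  rw [← hzero]
  field_simp
end

section
/- Let $A$ be a real $m \times n$ matrix with columns $A_{\cdot i} \in \mathbb{R}^m$, let $b \in \mathbb{R}^m$, and $\gamma > 0$. Suppose $x \ne 0$ is a local minimizer of $F(y) = \gamma \|y\|_1/\|y\|_2 + \tfrac12 \|A y - b\|_2^2$ on $\mathbb{R}^n \setminus \{0\}$. Set $a = \|x\|_1$ and $r = \|x\|_2$. Then for every index $i$ with $x_i \ne 0$, the second-order necessary condition yields $\|A_{\cdot i}\|_2^2 \ \ge\ \gamma\left( \dfrac{2 |x_i|}{r^3} + \dfrac{a}{r^3} - \dfrac{3 a\, x_i^2}{r^5} \right)$. -/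
/-- Second-order necessary condition for a local minimum of a function of one real variable. -/
theorem IsLocalMin.second_deriv_nonneg {f f' : ℝ → ℝ} {c x₀ : ℝ} (h : IsLocalMin f x₀)
    (hf : ∀ᶠ t in nhds x₀, HasDerivAt f (f' t) t) (hf' : HasDerivAt f' c x₀) : 0 ≤ c := by
  by_contra! hc
  have hd : deriv f =ᶠ[nhds x₀] f' := hf.mono fun t ht => ht.deriv
  have hdd : deriv (deriv f) x₀ = c := by rw [hd.deriv_eq, hf'.deriv]
  have hmax : IsLocalMax f x₀ :=
    isLocalMax_of_deriv_deriv_neg (hdd ▸ hc) h.deriv_eq_zero hf.self_of_nhds.continuousAt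
  have hconst : f =ᶠ[nhds x₀] fun _ => f x₀ := by
    filter_upwards [h, hmax] with t h₁ h₂ using le_antisymm h₂ h₁
  have hzero : deriv (deriv f) x₀ = 0 := by
    rw [hconst.deriv.deriv_eq]
    simp
  linarith

theorem Finset.sum_apply_add_single {ι : Type*} [Fintype ι] [DecidableEq ι] (g : ℝ → ℝ)
    (x : ι → ℝ) (i : ι) (t : ℝ) :
    ∑ j, g ((x + Pi.single i t : ι → ℝ) j) = ∑ j, g (x j) + (g (x i + t) - g (x i)) := by
  rw [← sub_eq_iff_eq_add', ← Finset.sum_sub_distrib, Finset.sum_eq_single i]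
  · simp
  · intro j _ hj
    simp [hj]
  · simp

theorem hasDerivAt_quadratic (q p c t : ℝ) :
    HasDerivAt (fun t => q + 2 * p * t + c * t ^ 2) (2 * p + 2 * c * t) t := by
  refine ((((hasDerivAt_id' t).const_mul (2 * p)).const_add q).fun_add
    ((hasDerivAt_pow 2 t).const_mul c)).congr_deriv ?_
  simp
  ring

/-- The first derivative of `(a + s t) / √(q + 2 p t + t²)`. -/
theorem hasDerivAt_affine_div_sqrt {a s q p t : ℝ} (h : 0 < q + 2 * p * t + t ^ 2) :
    HasDerivAt (fun t => (a + s * t) / √(q + 2 * p * t + t ^ 2))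
      (s / √(q + 2 * p * t + t ^ 2) -
        (a + s * t) * (p + t) / √(q + 2 * p * t + t ^ 2) ^ 3) t := by
  have hR : HasDerivAt (fun t : ℝ => q + 2 * p * t + t ^ 2) (2 * p + 2 * t) t := by
    simpa using hasDerivAt_quadratic q p 1 t
  have hN : HasDerivAt (fun t : ℝ => a + s * t) s t := by
    simpa using ((hasDerivAt_id t).const_mul s).const_add a
  have hpos := Real.sqrt_pos.2 h
  refine (hN.fun_div (hR.sqrt h.ne') hpos.ne').congr_deriv ?_
  generalize √(q + 2 * p * t + t ^ 2) = w at hpos ⊢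
  field_simp

/-- The second derivative at `0` of `(a + s t) / √(q + 2 p t + t²)`. -/
theorem hasDerivAt_deriv_affine_div_sqrt {a s q p : ℝ} (h : 0 < q) :
    HasDerivAt (fun t => s / √(q + 2 * p * t + t ^ 2) -
        (a + s * t) * (p + t) / √(q + 2 * p * t + t ^ 2) ^ 3)
      (3 * a * p ^ 2 / √q ^ 5 - a / √q ^ 3 - 2 * (s * p) / √q ^ 3) 0 := by
  have hR : HasDerivAt (fun t : ℝ => q + 2 * p * t + t ^ 2) (2 * p) 0 := by
    simpa using hasDerivAt_quadratic q p 1 0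
  have hN : HasDerivAt (fun t : ℝ => a + s * t) s 0 := by
    simpa using ((hasDerivAt_id (0 : ℝ)).const_mul s).const_add a
  have hP : HasDerivAt (fun t : ℝ => p + t) 1 0 := (hasDerivAt_id (0 : ℝ)).const_add p
  have hpos := Real.sqrt_pos.2 h
  have hS := hR.sqrt (by simpa using h.ne')
  refine (((hasDerivAt_const (0 : ℝ) s).fun_div hS (by simpa using hpos.ne')).fun_sub
    ((hN.fun_mul hP).fun_div (hS.fun_pow 3) (by simpa using hpos.ne'))).congr_deriv ?_
  simp only [mul_zero, add_zero, ne_eq, OfNat.ofNat_ne_zero, not_false_eq_true, zero_pow]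
  generalize √q = w at hpos ⊢
  field_simp
  ring

theorem eventually_abs_add_eq {p : ℝ} (hp : p ≠ 0) :
    ∀ᶠ t in nhds (0 : ℝ), |p + t| = |p| + SignType.sign p * t := by
  have hc : Filter.Tendsto (fun t : ℝ => p + t) (nhds 0) (nhds p) := by
    simpa using (continuous_const.add continuous_id).tendsto (0 : ℝ) (f := fun t => p + t)
  rcases hp.lt_or_gt with h | h
  · filter_upwards [hc.eventually_lt_const h] with t ht
    rw [abs_of_neg ht, abs_of_neg h, sign_neg h]
    simp
    ring
  · filter_upwards [hc.eventually_const_lt h] with t ht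
    rw [abs_of_pos ht, abs_of_pos h, sign_pos h]
    simp

theorem unconstrained_second_order_condition (m n : ℕ) (A : Matrix (Fin m) (Fin n) ℝ)
    (b : Fin m → ℝ) (γ : ℝ) (hγ : 0 < γ)
    (x : Fin n → ℝ) (hx : x ≠ 0)
    (hloc : IsLocalMinOn
      (fun y : Fin n → ℝ =>
        γ * ((∑ i, |y i|) / Real.sqrt (∑ i, (y i) ^ 2)) +
          (1 / 2) * ∑ k, (A.mulVec y k - b k) ^ 2)
      {y : Fin n → ℝ | y ≠ 0} x)
    (a r : ℝ) (ha : a = ∑ i, |x i|) (hr : r = Real.sqrt (∑ i, (x i) ^ 2)) :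
    ∀ i, x i ≠ 0 →
      γ * (2 * |x i| / r ^ 3 + a / r ^ 3 - 3 * a * (x i) ^ 2 / r ^ 5) ≤
        ∑ k, (A k i) ^ 2 := by
  intro i hi
  have hq : 0 < ∑ j, x j ^ 2 :=
    Finset.sum_pos' (fun j _ => sq_nonneg _) ⟨i, Finset.mem_univ i, by positivity⟩
  have hmin := hloc.isLocalMin (isOpen_ne.mem_nhds hx)
  have hline : Filter.Tendsto (fun t : ℝ => x + (Pi.single i t : Fin n → ℝ)) (nhds 0) (nhds x) := by
    have h : Continuous fun t : ℝ => x + (Pi.single i t : Fin n → ℝ) :=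
      continuous_const.add (continuous_single (A := fun _ : Fin n => ℝ) i)
    simpa using h.tendsto 0
  have habs := eventually_abs_add_eq hi
  set s : ℝ := ((SignType.sign (x i) : SignType) : ℝ)
  set u : Fin m → ℝ := fun k => A.mulVec x k - b k
  set φ : ℝ → ℝ := fun t =>
    γ * ((a + s * t) / √((∑ j, x j ^ 2) + 2 * x i * t + t ^ 2)) +
      (1 / 2) * ((∑ k, u k ^ 2) + 2 * (∑ k, u k * A k i) * t + (∑ k, A k i ^ 2) * t ^ 2)
  have hφ : ∀ᶠ t in nhds (0 : ℝ),
      (γ * ((∑ j, |(x + Pi.single i t : Fin n → ℝ) j|) /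
          √(∑ j, ((x + Pi.single i t : Fin n → ℝ) j) ^ 2)) +
        (1 / 2) * ∑ k, (A.mulVec (x + Pi.single i t) k - b k) ^ 2) = φ t := by
    filter_upwards [habs] with t ht
    have h₁ := Finset.sum_apply_add_single (fun z => |z|) x i t
    have h₂ := Finset.sum_apply_add_single (fun z => z ^ 2) x i t
    have h₃ : ∑ k, (A.mulVec (x + Pi.single i t) k - b k) ^ 2 =
        (∑ k, u k ^ 2) + 2 * (∑ k, u k * A k i) * t + (∑ k, A k i ^ 2) * t ^ 2 := by
      rw [Finset.mul_sum, Finset.sum_mul, Finset.sum_mul, ← Finset.sum_add_distrib,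
        ← Finset.sum_add_distrib]
      refine Finset.sum_congr rfl fun k _ => ?_
      simp only [Matrix.mulVec_add, Matrix.mulVec_single, Pi.add_apply, Pi.smul_apply,
        Matrix.col_apply, MulOpposite.smul_eq_mul_unop, MulOpposite.unop_op, u]
      ring
    rw [h₁, h₂, h₃, ht, ← ha]
    simp only [φ]
    congr 4 <;> ring_nf
  have hmin₀ : IsLocalMin φ 0 := by
    refine Filter.EventuallyEq.isLocalMin_iff hφ |>.1 ?_
    have h := hline.eventually hmin
    simpa [IsLocalMin, IsMinFilter] using h
  have hev : ∀ᶠ t in nhds (0 : ℝ), 0 < (∑ j, x j ^ 2) + 2 * x i * t + t ^ 2 := by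
    have hc : Continuous fun t : ℝ => (∑ j, x j ^ 2) + 2 * x i * t + t ^ 2 := by fun_prop
    exact (hc.tendsto 0).eventually_const_lt (by simpa using hq)
  have key := hmin₀.second_deriv_nonneg
    (hev.mono fun t ht => ((hasDerivAt_affine_div_sqrt ht).const_mul γ).fun_add
      ((hasDerivAt_quadratic _ _ _ t).const_mul (1 / 2)))
    (((hasDerivAt_deriv_affine_div_sqrt hq).const_mul γ).fun_add
      ((((hasDerivAt_id' (0 : ℝ)).const_mul (2 * ∑ k, A k i ^ 2)).const_add _).const_mul (1 / 2)))
  have hs : s * x i = |x i| := sign_mul_self (x i)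
  rw [← hr, hs] at key
  have : γ * (2 * |x i| / r ^ 3 + a / r ^ 3 - 3 * a * x i ^ 2 / r ^ 5) =
      -(γ * (3 * a * x i ^ 2 / r ^ 5 - a / r ^ 3 - 2 * |x i| / r ^ 3)) := by ring
  linarith
end

section
/- Let $n \ge 1$ and $a \in \mathbb{R}^n$. Let $\mathcal{H}$ be the set of pairs $(x, y)$ with $x, y \in \mathbb{R}^n$, $x_i \ge 0$ and $y_i \ge 0$ for all $i$, $\langle a, x\rangle = \langle a, y\rangle$, and $x_i + y_i = 1$ for all $i$. Then: (1) for every $(x,y) \in \mathcal{H}$, $\|x\|_1 + \|y\|_1 \ge \sqrt{n} \cdot \sqrt{\|x\|_2^2 + \|y\|_2^2}$; and (2) there exists $(x,y) \in \mathcal{H}$ for which equality holds if and only if there exists a subset $S \subseteq \{1,\dots,n\}$ with $\sum_{i \in S} a_i = \sum_{i \notin S} a_i$ (an equitable bipartition). -/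
theorem sum_abs_add_sum_abs_of_add_eq_one {n : ℕ} {x y : Fin n → ℝ} (hx : ∀ i, 0 ≤ x i)
    (hy : ∀ i, 0 ≤ y i) (hxy : ∀ i, x i + y i = 1) :
    (∑ i, |x i|) + ∑ i, |y i| = n := by
  simp [← Finset.sum_add_distrib, abs_of_nonneg (hx _), abs_of_nonneg (hy _), hxy]

theorem sum_sq_add_sum_sq_of_add_eq_one {n : ℕ} {x y : Fin n → ℝ}
    (hxy : ∀ i, x i + y i = 1) :
    (∑ i, (x i) ^ 2) + ∑ i, (y i) ^ 2 = n - 2 * ∑ i, x i * y i := by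
  have h (i : Fin n) : x i ^ 2 + y i ^ 2 = 1 - 2 * (x i * y i) := by
    linear_combination (x i + y i + 1) * hxy i
  simp [← Finset.sum_add_distrib, h, Finset.mul_sum]


theorem partition_reduction_constrained (n : ℕ) (hn : 1 ≤ n) (a : Fin n → ℝ) :
    (∀ x y : Fin n → ℝ, (∀ i, 0 ≤ x i) → (∀ i, 0 ≤ y i) →
      (∑ i, a i * x i) = (∑ i, a i * y i) → (∀ i, x i + y i = 1) →
      Real.sqrt n * Real.sqrt ((∑ i, (x i) ^ 2) + ∑ i, (y i) ^ 2) ≤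
        (∑ i, |x i|) + ∑ i, |y i|) ∧
    ((∃ x y : Fin n → ℝ, (∀ i, 0 ≤ x i) ∧ (∀ i, 0 ≤ y i) ∧
        (∑ i, a i * x i) = (∑ i, a i * y i) ∧ (∀ i, x i + y i = 1) ∧
        (∑ i, |x i|) + ∑ i, |y i| =
          Real.sqrt n * Real.sqrt ((∑ i, (x i) ^ 2) + ∑ i, (y i) ^ 2)) ↔
      ∃ S : Finset (Fin n), ∑ i ∈ S, a i = ∑ i ∈ Sᶜ, a i) := by
  refine ⟨fun x y hx hy _ hxy => ?_, ?_, ?_⟩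
  · rw [sum_abs_add_sum_abs_of_add_eq_one hx hy hxy, sum_sq_add_sum_sq_of_add_eq_one hxy]
    calc √(n : ℝ) * √(n - 2 * ∑ i, x i * y i) ≤ √(n : ℝ) * √(n : ℝ) := by
          have : 0 ≤ ∑ i, x i * y i := Finset.sum_nonneg fun i _ => mul_nonneg (hx i) (hy i)
          gcongr
          linarith
      _ = n := Real.mul_self_sqrt n.cast_nonneg
  · rintro ⟨x, y, hx, hy, hbal, hxy, heq⟩
    rw [sum_abs_add_sum_abs_of_add_eq_one hx hy hxy, sum_sq_add_sum_sq_of_add_eq_one hxy] at heq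
    have hn0 : (0 : ℝ) < n := by exact_mod_cast hn
    have hsqrt : √(n : ℝ) = √(n - 2 * ∑ i, x i * y i) :=
      mul_left_cancel₀ (Real.sqrt_pos.2 hn0).ne' ((Real.mul_self_sqrt hn0.le).trans heq)
    have hpos : 0 < (n : ℝ) - 2 * ∑ i, x i * y i :=
      Real.sqrt_pos.1 (hsqrt ▸ Real.sqrt_pos.2 hn0)
    have hsum : ∑ i, x i * y i = 0 := by
      linarith [(Real.sqrt_inj hn0.le hpos.le).1 hsqrt]
    have hmul (i : Fin n) : x i * y i = 0 :=
      (Finset.sum_eq_zero_iff_of_nonneg fun i _ => mul_nonneg (hx i) (hy i)).1 hsum i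
        (Finset.mem_univ i)
    refine ⟨Finset.univ.filter fun i => x i = 1, ?_⟩
    rw [Finset.compl_filter, Finset.sum_filter, Finset.sum_filter]
    convert hbal using 2 with i _ i _ <;>
      rcases mul_eq_zero.1 (hmul i) with h | h <;>
      have h' := hxy i <;> simp_all
  · rintro ⟨S, hS⟩
    have hxy (i : Fin n) : (if i ∈ S then (1 : ℝ) else 0) + (if i ∈ S then 0 else 1) = 1 := by
      split_ifs <;> simp
    have hx (i : Fin n) : 0 ≤ (if i ∈ S then (1 : ℝ) else 0) := by positivity
    have hy (i : Fin n) : 0 ≤ (if i ∈ S then (0 : ℝ) else 1) := by positivity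
    refine ⟨fun i => if i ∈ S then 1 else 0, fun i => if i ∈ S then 0 else 1,
      hx, hy, ?_, hxy, ?_⟩
    · have hSc : ∑ i ∈ Sᶜ, a i = ∑ i, if i ∈ S then 0 else a i := by
        rw [← Finset.sum_add_sum_compl S fun i => if i ∈ S then 0 else a i,
          Finset.sum_eq_zero fun i hi => if_pos hi, zero_add]
        exact Finset.sum_congr rfl fun i hi => (if_neg (Finset.mem_compl.1 hi)).symm
      simpa [hSc] using hS
    · rw [sum_abs_add_sum_abs_of_add_eq_one hx hy hxy, sum_sq_add_sum_sq_of_add_eq_one hxy]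
      have hmul (i : Fin n) :
          (if i ∈ S then (1 : ℝ) else 0) * (if i ∈ S then 0 else 1) = 0 := by
        split_ifs <;> simp
      simp only [hmul, Finset.sum_const_zero, mul_zero, sub_zero]
      exact (Real.mul_self_sqrt n.cast_nonneg).symm
end

section
/- Let $n, m \ge 1$, $a \in \mathbb{R}^n$, and $\kappa \in \mathbb{R}$. Let $\mathcal{H}$ be the set of matrices $X = (X_{ij}) \in \mathbb{R}^{n \times m}$ with $X_{ij} \ge 0$ for all $i,j$, $\sum_{j=1}^m X_{ij} = 1$ for every row $i$, and $\sum_{i=1}^n a_i X_{ij} = \kappa$ for every column $j$. Then: (1) for every $X \in \mathcal{H}$, $\sum_{i,j} X_{ij} \ge \sqrt{n} \cdot \sqrt{\sum_{i,j} X_{ij}^2}$; and (2) there exists $X \in \mathcal{H}$ for which equality holds if and only if there exists a function $f : \{1,\dots,n\} \to \{1,\dots,m\}$ such that $\sum_{i : f(i) = j} a_i = \kappa$ for every $j$ (a partition of the index set into $m$ groups each with sum $\kappa$). -/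
section RowStochastic

variable {n m : ℕ} {X : Fin n → Fin m → ℝ}

theorem sq_le_self_of_row_stochastic (h0 : ∀ i j, 0 ≤ X i j) (h1 : ∀ i, ∑ j, X i j = 1)
    (i : Fin n) (j : Fin m) : X i j ^ 2 ≤ X i j := by
  have h : X i j ≤ 1 :=
    h1 i ▸ Finset.single_le_sum (fun k _ => h0 i k) (Finset.mem_univ j)
  nlinarith [h0 i j]

theorem sum_eq_card_of_row_sum_one (h1 : ∀ i, ∑ j, X i j = 1) : ∑ i, ∑ j, X i j = (n : ℝ) := by
  simp [h1]

theorem sum_sq_le_card_of_row_stochastic (h0 : ∀ i j, 0 ≤ X i j) (h1 : ∀ i, ∑ j, X i j = 1) :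
    ∑ i, ∑ j, X i j ^ 2 ≤ (n : ℝ) :=
  sum_eq_card_of_row_sum_one h1 ▸ Finset.sum_le_sum fun i _ =>
    Finset.sum_le_sum fun j _ => sq_le_self_of_row_stochastic h0 h1 i j

/-- A row-stochastic matrix whose squared entries sum to the number of rows is the indicator
matrix of a function from rows to columns. -/
theorem exists_eq_indicator_of_sum_sq_eq_card (h0 : ∀ i j, 0 ≤ X i j)
    (h1 : ∀ i, ∑ j, X i j = 1) (h2 : ∑ i, ∑ j, X i j ^ 2 = (n : ℝ)) :
    ∃ f : Fin n → Fin m, ∀ i j, X i j = if f i = j then 1 else 0 := by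
  have hle := sq_le_self_of_row_stochastic h0 h1
  have hsq : ∀ i j, X i j ^ 2 = X i j := by
    intro i j
    have hrow := (Finset.sum_eq_sum_iff_of_le fun i _ => Finset.sum_le_sum fun j _ => hle i j).1
      (h2.trans (sum_eq_card_of_row_sum_one h1).symm) i (Finset.mem_univ i)
    exact (Finset.sum_eq_sum_iff_of_le fun j _ => hle i j).1 hrow j (Finset.mem_univ j)
  have hne : ∀ i, ∃ j, X i j ≠ 0 := by
    intro i
    by_contra! h
    simpa [h] using h1 i
  choose f hf using hne
  have hone : ∀ i, X i (f i) = 1 := fun i =>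
    mul_left_cancel₀ (hf i) (by rw [mul_one, ← sq, hsq])
  refine ⟨f, fun i j => ?_⟩
  split_ifs with hj
  · rw [← hj, hone]
  · have hsplit := Finset.add_sum_erase Finset.univ (X i) (Finset.mem_univ (f i))
    rw [h1, hone, add_eq_left] at hsplit
    exact (Finset.sum_eq_zero_iff_of_nonneg fun k _ => h0 i k).1 hsplit j
      (Finset.mem_erase.2 ⟨Ne.symm hj, Finset.mem_univ j⟩)

end RowStochastic


theorem three_partition_reduction_constrained (n m : ℕ) (hn : 1 ≤ n) (hm : 1 ≤ m)
    (a : Fin n → ℝ) (κ : ℝ) :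
    (∀ X : Fin n → Fin m → ℝ, (∀ i j, 0 ≤ X i j) →
      (∀ i, ∑ j, X i j = 1) → (∀ j, ∑ i, a i * X i j = κ) →
      Real.sqrt n * Real.sqrt (∑ i, ∑ j, (X i j) ^ 2) ≤ ∑ i, ∑ j, X i j) ∧
    ((∃ X : Fin n → Fin m → ℝ, (∀ i j, 0 ≤ X i j) ∧
        (∀ i, ∑ j, X i j = 1) ∧ (∀ j, ∑ i, a i * X i j = κ) ∧
        (∑ i, ∑ j, X i j) = Real.sqrt n * Real.sqrt (∑ i, ∑ j, (X i j) ^ 2)) ↔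
      ∃ f : Fin n → Fin m, ∀ j, ∑ i ∈ Finset.univ.filter (fun i => f i = j), a i = κ) := by
  have hn0 : (0 : ℝ) < n := by exact_mod_cast hn
  refine ⟨fun X h0 h1 _ => ?_, ?_, ?_⟩
  · rw [sum_eq_card_of_row_sum_one h1]
    calc √(n : ℝ) * √(∑ i, ∑ j, X i j ^ 2) ≤ √(n : ℝ) * √(n : ℝ) := by
          gcongr
          exact sum_sq_le_card_of_row_stochastic h0 h1
      _ = n := Real.mul_self_sqrt hn0.le
  · rintro ⟨X, h0, h1, hκ, heq⟩
    have hsum : ∑ i, ∑ j, X i j ^ 2 = (n : ℝ) := by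
      rw [sum_eq_card_of_row_sum_one h1, ← Real.mul_self_sqrt hn0.le,
        Real.sqrt_mul_self (Real.sqrt_nonneg _)] at heq
      have h := mul_left_cancel₀ (Real.sqrt_ne_zero'.2 hn0) heq
      exact ((Real.sqrt_inj hn0.le
        (Finset.sum_nonneg fun i _ => Finset.sum_nonneg fun j _ => sq_nonneg _)).1 h).symm
    obtain ⟨f, hf⟩ := exists_eq_indicator_of_sum_sq_eq_card h0 h1 hsum
    refine ⟨f, fun j => ?_⟩
    rw [Finset.sum_filter, ← hκ j]
    simp [hf]
  · rintro ⟨f, hf⟩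
    refine ⟨fun i j => if f i = j then 1 else 0, fun i j => by positivity, fun i => by simp,
      fun j => ?_, ?_⟩
    · rw [← hf j, Finset.sum_filter]
      simp
    · simp [Real.mul_self_sqrt hn0.le]
end

section
/- Let $n \ge 1$ and $a \in \mathbb{R}^n$. For $x, y \in \mathbb{R}^n$ with $x_i \ge 0$, $y_i \ge 0$ for all $i$ and $(x,y) \ne (0,0)$, define $P(x,y) = \dfrac{1}{2} \cdot \dfrac{\|x\|_1 + \|y\|_1}{\sqrt{\|x\|_2^2 + \|y\|_2^2}} + \langle a, x - y\rangle^2 + \sum_{i=1}^n (x_i + y_i - 1)^2$. Then: (1) $P(x,y) \ge \tfrac{\sqrt{n}}{2}$ for all such $(x,y)$; and (2) there exist nonnegative $(x,y) \ne (0,0)$ with $P(x,y) = \tfrac{\sqrt{n}}{2}$ if and only if there exists a subset $S \subseteq \{1,\dots,n\}$ with $\sum_{i \in S} a_i = \sum_{i \notin S} a_i$ (an equitable bipartition). -/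
/-- The ratio of the `ℓ¹` and `ℓ²` norms plus the squared distance to the all-ones vector
is at least `√n`. -/
lemma sqrt_le_sum_div_sqrt_add {n : ℕ} (hn : 1 ≤ n) (s : Fin n → ℝ) (hs : ∀ i, 0 ≤ s i)
    (h : 0 < ∑ i, s i ^ 2) :
    √n ≤ (∑ i, s i) / √(∑ i, s i ^ 2) + ∑ i, (s i - 1) ^ 2 := by
  have hB : 0 < √(∑ i, s i ^ 2) := Real.sqrt_pos.2 h
  have hB2 : √(∑ i, s i ^ 2) ^ 2 = ∑ i, s i ^ 2 := Real.sq_sqrt h.le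
  have hA : 0 ≤ ∑ i, s i := Finset.sum_nonneg fun i _ => hs i
  have hpen : ∑ i, (s i - 1) ^ 2 = ∑ i, s i ^ 2 - 2 * ∑ i, s i + n := by
    simp [sub_sq, Finset.sum_add_distrib, Finset.sum_sub_distrib, Finset.mul_sum]
  have hCS : (∑ i, s i) ^ 2 ≤ n * ∑ i, s i ^ 2 := by
    simpa using sq_sum_le_card_mul_sum_sq (s := Finset.univ) (f := s)
  rw [hpen]
  generalize √(∑ i, s i ^ 2) = B at hB hB2
  rw [← hB2] at hCS ⊢
  generalize ∑ i, s i = A at hA hCS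
  obtain ⟨r, rfl⟩ : ∃ r, A = r * B := ⟨A / B, by field_simp⟩
  rw [mul_div_cancel_right₀ _ hB.ne']
  have hr : 0 ≤ r := nonneg_of_mul_nonneg_left hA hB
  have hrn : r ≤ √n := by
    apply Real.le_sqrt_of_sq_le
    rw [mul_pow] at hCS
    exact le_of_mul_le_mul_right hCS (by positivity)
  have h1 : 1 ≤ √(n : ℝ) := Real.one_le_sqrt.2 (by exact_mod_cast hn)
  have hN : √(n : ℝ) ^ 2 = n := Real.sq_sqrt (Nat.cast_nonneg n)
  nlinarith [sq_nonneg (B - r), mul_nonneg (sub_nonneg.2 hrn) (add_nonneg (sub_nonneg.2 h1) hr)]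

lemma sum_sq_add_sum_sq_pos {ι : Type*} [Fintype ι] {x y : ι → ℝ} (h : ¬(x = 0 ∧ y = 0)) :
    0 < (∑ i, x i ^ 2) + ∑ i, y i ^ 2 := by
  have hx : 0 ≤ ∑ i, x i ^ 2 := Finset.sum_nonneg fun i _ => sq_nonneg _
  have hy : 0 ≤ ∑ i, y i ^ 2 := Finset.sum_nonneg fun i _ => sq_nonneg _
  refine lt_of_le_of_ne (add_nonneg hx hy) fun h0 => h ?_
  have hx0 : ∑ i, x i ^ 2 = 0 := by linarith
  have hy0 : ∑ i, y i ^ 2 = 0 := by linarith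
  rw [Finset.sum_eq_zero_iff_of_nonneg fun i _ => sq_nonneg _] at hx0 hy0
  exact ⟨funext fun i => by simpa using hx0 i, funext fun i => by simpa using hy0 i⟩

lemma sqrt_le_sum_add_sum_div_sqrt_add {n : ℕ} (hn : 1 ≤ n) {x y : Fin n → ℝ}
    (hx : ∀ i, 0 ≤ x i) (hy : ∀ i, 0 ≤ y i) (h : ¬(x = 0 ∧ y = 0)) :
    √n ≤ ((∑ i, |x i|) + ∑ i, |y i|) / √((∑ i, x i ^ 2) + ∑ i, y i ^ 2) +
      ∑ i, (x i + y i - 1) ^ 2 := by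
  have hpos := sum_sq_add_sum_sq_pos h
  have hle : (∑ i, x i ^ 2) + ∑ i, y i ^ 2 ≤ ∑ i, (x i + y i) ^ 2 := by
    rw [← Finset.sum_add_distrib]
    exact Finset.sum_le_sum fun i _ => by nlinarith [mul_nonneg (hx i) (hy i)]
  refine (sqrt_le_sum_div_sqrt_add hn (fun i => x i + y i)
    (fun i => add_nonneg (hx i) (hy i)) (hpos.trans_le hle)).trans ?_
  simp only [abs_of_nonneg (hx _), abs_of_nonneg (hy _), ← Finset.sum_add_distrib] at hpos hle ⊢
  gcongr
  exact Finset.sum_nonneg fun i _ => add_nonneg (hx i) (hy i)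

/-- If nonnegative `x`, `y` satisfy `x + y = 1` and the `ℓ¹/ℓ²` ratio of `(x, y)` is `√n`, then
`x` and `y` have disjoint supports. -/
lemma mul_eq_zero_of_ratio_eq_sqrt {n : ℕ} (hn : 1 ≤ n) {x y : Fin n → ℝ}
    (hx : ∀ i, 0 ≤ x i) (hy : ∀ i, 0 ≤ y i) (hxy : ∀ i, x i + y i = 1)
    (h : ((∑ i, |x i|) + ∑ i, |y i|) / √((∑ i, x i ^ 2) + ∑ i, y i ^ 2) = √n) (i : Fin n) :
    x i * y i = 0 := by
  have hn0 : (0 : ℝ) < n := by exact_mod_cast hn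
  simp only [abs_of_nonneg (hx _), abs_of_nonneg (hy _), ← Finset.sum_add_distrib, hxy] at h
  have h0 : 0 ≤ ∑ i, (x i ^ 2 + y i ^ 2) := Finset.sum_nonneg fun i _ => by positivity
  have hsum : ∑ i, (x i ^ 2 + y i ^ 2) = n := by
    have h2 := congrArg (· ^ 2) h
    simp only [div_pow, Real.sq_sqrt h0, Real.sq_sqrt hn0.le] at h2
    have hne : ∑ i, (x i ^ 2 + y i ^ 2) ≠ 0 := by
      intro hz
      rw [hz, div_zero] at h2
      exact hn0.ne h2
    rw [div_eq_iff hne] at h2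
    simp only [Finset.sum_const, Finset.card_univ, Fintype.card_fin, nsmul_eq_mul, mul_one,
      sq (n : ℝ)] at h2
    exact (mul_left_cancel₀ hn0.ne' h2).symm
  have hprod : ∑ i, x i * y i = 0 := by
    have h1 : ∑ i, (x i + y i) ^ 2 = n := by simp [hxy]
    have h2 : ∑ i, (x i + y i) ^ 2 = ∑ i, (x i ^ 2 + y i ^ 2) + 2 * ∑ i, x i * y i := by
      rw [Finset.mul_sum, ← Finset.sum_add_distrib]
      exact Finset.sum_congr rfl fun i _ => by ring
    linarith
  exact (Finset.sum_eq_zero_iff_of_nonneg fun i _ => mul_nonneg (hx i) (hy i)).1 hprod i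
    (Finset.mem_univ i)

theorem partition_reduction_unconstrained (n : ℕ) (hn : 1 ≤ n) (a : Fin n → ℝ)
    (P : (Fin n → ℝ) → (Fin n → ℝ) → ℝ)
    (hP : ∀ x y, P x y =
      (1 / 2) * (((∑ i, |x i|) + ∑ i, |y i|) /
        Real.sqrt ((∑ i, (x i) ^ 2) + ∑ i, (y i) ^ 2)) +
      (∑ i, a i * (x i - y i)) ^ 2 + ∑ i, (x i + y i - 1) ^ 2) :
    (∀ x y : Fin n → ℝ, (∀ i, 0 ≤ x i) → (∀ i, 0 ≤ y i) → ¬(x = 0 ∧ y = 0) →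
      Real.sqrt n / 2 ≤ P x y) ∧
    ((∃ x y : Fin n → ℝ, (∀ i, 0 ≤ x i) ∧ (∀ i, 0 ≤ y i) ∧ ¬(x = 0 ∧ y = 0) ∧
        P x y = Real.sqrt n / 2) ↔
      ∃ S : Finset (Fin n), ∑ i ∈ S, a i = ∑ i ∈ Sᶜ, a i) := by
  refine ⟨fun x y hx hy h => ?_, ?_, ?_⟩
  · have hkey := sqrt_le_sum_add_sum_div_sqrt_add hn hx hy h
    have hpen : 0 ≤ ∑ i, (x i + y i - 1) ^ 2 := Finset.sum_nonneg fun i _ => sq_nonneg _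
    rw [hP]
    linarith [sq_nonneg (∑ i, a i * (x i - y i))]
  · rintro ⟨x, y, hx, hy, h, hval⟩
    have hkey := sqrt_le_sum_add_sum_div_sqrt_add hn hx hy h
    have hpen : 0 ≤ ∑ i, (x i + y i - 1) ^ 2 := Finset.sum_nonneg fun i _ => sq_nonneg _
    have hsq := sq_nonneg (∑ i, a i * (x i - y i))
    rw [hP] at hval
    have hpen0 : ∑ i, (x i + y i - 1) ^ 2 = 0 := by linarith
    have hbal : ∑ i, a i * (x i - y i) = 0 := by
      rw [← sq_eq_zero_iff]
      linarith
    have hxy : ∀ i, x i + y i = 1 := fun i => sub_eq_zero.1 <| sq_eq_zero_iff.1 <|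
      (Finset.sum_eq_zero_iff_of_nonneg fun i _ => sq_nonneg _).1 hpen0 i (Finset.mem_univ i)
    have hdisj := mul_eq_zero_of_ratio_eq_sqrt hn hx hy hxy (by linarith)
    refine ⟨Finset.univ.filter fun i => y i = 0, ?_⟩
    rw [← Finset.sum_filter_add_sum_filter_not Finset.univ (fun i => y i = 0),
      ← Finset.compl_filter] at hbal
    have h1 : ∑ i with y i = 0, a i * (x i - y i) = ∑ i with y i = 0, a i :=
      Finset.sum_congr rfl fun i hi => by
        have hyi : y i = 0 := (Finset.mem_filter.1 hi).2
        have hxi : x i = 1 := by linarith [hxy i]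
        simp [hxi, hyi]
    have h2 : ∑ i ∈ (Finset.univ.filter fun i => y i = 0)ᶜ, a i * (x i - y i) =
        -∑ i ∈ (Finset.univ.filter fun i => y i = 0)ᶜ, a i := by
      rw [← Finset.sum_neg_distrib]
      refine Finset.sum_congr rfl fun i hi => ?_
      have hyi : y i ≠ 0 := by simpa using hi
      have hxi : x i = 0 := (mul_eq_zero.1 (hdisj i)).resolve_right hyi
      have hyi1 : y i = 1 := by linarith [hxy i]
      simp [hxi, hyi1]
    linarith
  · rintro ⟨S, hS⟩
    have hxy : ∀ i, (if i ∈ S then (1 : ℝ) else 0) + (if i ∈ S then 0 else 1) = 1 := fun i => by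
      split_ifs <;> simp
    refine ⟨fun i => if i ∈ S then 1 else 0, fun i => if i ∈ S then 0 else 1,
      fun i => by dsimp only; split_ifs <;> simp, fun i => by dsimp only; split_ifs <;> simp,
      ?_, ?_⟩
    · rintro ⟨h1, h2⟩
      have h3 := hxy ⟨0, hn⟩
      have h4 := congrFun h1 ⟨0, hn⟩
      have h5 := congrFun h2 ⟨0, hn⟩
      simp only [Pi.zero_apply] at h4 h5
      linarith
    · have hbal : ∑ i, a i * ((if i ∈ S then (1 : ℝ) else 0) - (if i ∈ S then 0 else 1)) = 0 := by
        have h1 : ∑ i ∈ S, a i * ((if i ∈ S then (1 : ℝ) else 0) - (if i ∈ S then 0 else 1)) =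
            ∑ i ∈ S, a i := Finset.sum_congr rfl fun i hi => by simp [hi]
        have h2 : ∑ i ∈ Sᶜ, a i * ((if i ∈ S then (1 : ℝ) else 0) - (if i ∈ S then 0 else 1)) =
            -∑ i ∈ Sᶜ, a i := by
          rw [← Finset.sum_neg_distrib]
          exact Finset.sum_congr rfl fun i hi => by simp [Finset.mem_compl.1 hi]
        rw [← Finset.sum_add_sum_compl S, h1, h2, hS, add_neg_cancel]
      rw [hP, hbal]
      simp only [apply_ite abs, ite_pow, abs_one, abs_zero, one_pow, ne_eq, OfNat.ofNat_ne_zero,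
        not_false_eq_true, zero_pow, ← Finset.sum_add_distrib, hxy, sub_self, Finset.sum_const,
        Finset.card_univ, Fintype.card_fin, nsmul_eq_mul, mul_one, mul_zero, add_zero,
        Real.div_sqrt]
      ring
end

section
/- Let $n, m \ge 1$, $a \in \mathbb{R}^n$, and $\kappa \in \mathbb{R}$. For a matrix $X = (X_{ij}) \in \mathbb{R}^{n \times m}$ with $X_{ij} \ge 0$ for all $i,j$ and $X \ne 0$, define $P(X) = \dfrac{1}{2} \cdot \dfrac{\sum_{i,j} X_{ij}}{\sqrt{\sum_{i,j} X_{ij}^2}} + \sum_{i=1}^n \Big(\sum_{j=1}^m X_{ij} - 1\Big)^2 + \sum_{j=1}^m \Big(\sum_{i=1}^n a_i X_{ij} - \kappa\Big)^2$. Then: (1) $P(X) \ge \tfrac{\sqrt{n}}{2}$ for all such $X$; and (2) there exists a nonnegative $X \ne 0$ with $P(X) = \tfrac{\sqrt{n}}{2}$ if and only if there exists a function $f : \{1,\dots,n\} \to \{1,\dots,m\}$ such that $\sum_{i : f(i) = j} a_i = \kappa$ for every $j$ (a partition of the index set into $m$ groups each with sum $\kappa$). -/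
/-- With `r` a nonnegative vector and `q` at most its squared `ℓ²` norm, the scaled ratio `ℓ¹ / √q`
cannot be smaller than `√n` by more than the squared distance of `r` to the all-ones vector. -/
theorem sqrt_card_le_ratio_add_sum_sq {n : ℕ} (hn : 1 ≤ n) {r : Fin n → ℝ} (hr : ∀ i, 0 ≤ r i)
    {q : ℝ} (hq : 0 < q) (hqr : q ≤ ∑ i, r i ^ 2) :
    Real.sqrt n ≤ (∑ i, r i) / Real.sqrt q + ∑ i, (r i - 1) ^ 2 := by
  set S := ∑ i, r i with hS
  set R := ∑ i, r i ^ 2 with hR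
  have hS0 : 0 ≤ S := Finset.sum_nonneg fun i _ => hr i
  have hR0 : 0 < R := hq.trans_le hqr
  have hD : ∑ i, (r i - 1) ^ 2 = R - 2 * S + n := by
    simp only [sub_sq, Finset.sum_add_distrib, Finset.sum_sub_distrib, mul_one, one_pow,
      ← Finset.mul_sum, Finset.sum_const, Finset.card_univ, Fintype.card_fin, nsmul_eq_mul]
    rw [← hS, ← hR]
  set c := S / Real.sqrt R with hc
  have hc0 : 0 ≤ c := by positivity
  have hcS : c * Real.sqrt R = S := div_mul_cancel₀ _ (Real.sqrt_pos.2 hR0).ne'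
  have hRR : Real.sqrt R ^ 2 = R := Real.sq_sqrt hR0.le
  have hct : c ≤ S / Real.sqrt q :=
    div_le_div_of_nonneg_left hS0 (Real.sqrt_pos.2 hq) (Real.sqrt_le_sqrt hqr)
  have hs : Real.sqrt n ^ 2 = n := Real.sq_sqrt n.cast_nonneg
  have hs1 : 1 ≤ Real.sqrt n := Real.one_le_sqrt.2 (by exact_mod_cast hn)
  have hDc : Real.sqrt n ^ 2 - c ^ 2 ≤ ∑ i, (r i - 1) ^ 2 := by
    rw [hD, hs, ← hcS]
    nlinarith [sq_nonneg (Real.sqrt R - c)]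
  have hD0 : 0 ≤ ∑ i, (r i - 1) ^ 2 := Finset.sum_nonneg fun i _ => sq_nonneg _
  rcases le_total (Real.sqrt n) c with h | h
  · linarith
  · nlinarith [mul_nonneg (sub_nonneg.2 h) (add_nonneg (sub_nonneg.2 hs1) hc0)]

theorem sum_sum_sq_pos {ι κ : Type*} [Fintype ι] [Fintype κ] {X : ι → κ → ℝ} (hX : X ≠ 0) :
    0 < ∑ i, ∑ j, X i j ^ 2 := by
  obtain ⟨i, hi⟩ := Function.ne_iff.1 hX
  obtain ⟨j, hj⟩ := Function.ne_iff.1 hi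
  refine Finset.sum_pos' (fun i _ => Finset.sum_nonneg fun j _ => sq_nonneg _)
    ⟨i, Finset.mem_univ i, ?_⟩
  exact Finset.sum_pos' (fun j _ => sq_nonneg _) ⟨j, Finset.mem_univ j, sq_pos_iff.2 hj⟩

/-- A nonnegative row-stochastic matrix whose squared entries also sum to the number of rows is the
indicator matrix of a function. -/
theorem exists_eq_ite_of_sum_sq_eq_card {n m : ℕ} {X : Fin n → Fin m → ℝ} (hX : ∀ i j, 0 ≤ X i j)
    (hrow : ∀ i, ∑ j, X i j = 1) (hsq : ∑ i, ∑ j, X i j ^ 2 = n) :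
    ∃ f : Fin n → Fin m, ∀ i j, X i j = if f i = j then 1 else 0 := by
  have hle : ∀ i j, X i j ≤ 1 := fun i j =>
    (Finset.single_le_sum (fun j _ => hX i j) (Finset.mem_univ j)).trans_eq (hrow i)
  have hnn : ∀ i j, 0 ≤ X i j - X i j ^ 2 := fun i j => by nlinarith [hX i j, hle i j]
  have hzero : ∑ i, ∑ j, (X i j - X i j ^ 2) = 0 := by
    simp [Finset.sum_sub_distrib, hrow, hsq]
  have h01 : ∀ i j, X i j - X i j ^ 2 = 0 := fun i j => by
    rw [Finset.sum_eq_zero_iff_of_nonneg fun i _ => Finset.sum_nonneg fun j _ => hnn i j] at hzero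
    exact (Finset.sum_eq_zero_iff_of_nonneg fun j _ => hnn i j).1 (hzero i (Finset.mem_univ i)) j
      (Finset.mem_univ j)
  have hex : ∀ i, ∃ j, X i j = 1 := fun i => by
    obtain ⟨j, -, hj⟩ := Finset.exists_ne_zero_of_sum_ne_zero ((hrow i).trans_ne one_ne_zero)
    exact ⟨j, mul_left_cancel₀ hj (by linarith [h01 i j])⟩
  choose f hf using hex
  refine ⟨f, fun i j => ?_⟩
  split_ifs with h
  · rw [← h, hf]
  · have := Finset.add_le_sum (fun j _ => hX i j) (Finset.mem_univ (f i)) (Finset.mem_univ j) h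
    linarith [hX i j, hf i, hrow i]

theorem three_partition_reduction_unconstrained (n m : ℕ) (hn : 1 ≤ n) (hm : 1 ≤ m)
    (a : Fin n → ℝ) (κ : ℝ)
    (P : (Fin n → Fin m → ℝ) → ℝ)
    (hP : ∀ X, P X =
      (1 / 2) * ((∑ i, ∑ j, X i j) / Real.sqrt (∑ i, ∑ j, (X i j) ^ 2)) +
      (∑ i, ((∑ j, X i j) - 1) ^ 2) +
      ∑ j, ((∑ i, a i * X i j) - κ) ^ 2) :
    (∀ X : Fin n → Fin m → ℝ, (∀ i j, 0 ≤ X i j) → X ≠ 0 →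
      Real.sqrt n / 2 ≤ P X) ∧
    ((∃ X : Fin n → Fin m → ℝ, (∀ i j, 0 ≤ X i j) ∧ X ≠ 0 ∧
        P X = Real.sqrt n / 2) ↔
      ∃ f : Fin n → Fin m, ∀ j, ∑ i ∈ Finset.univ.filter (fun i => f i = j), a i = κ) := by
  have key : ∀ X : Fin n → Fin m → ℝ, (∀ i j, 0 ≤ X i j) → X ≠ 0 →
      Real.sqrt n ≤ (∑ i, ∑ j, X i j) / Real.sqrt (∑ i, ∑ j, X i j ^ 2) +
        ∑ i, ((∑ j, X i j) - 1) ^ 2 := fun X hX h0 =>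
    sqrt_card_le_ratio_add_sum_sq hn (fun i => Finset.sum_nonneg fun j _ => hX i j)
      (sum_sum_sq_pos h0)
      (Finset.sum_le_sum fun i _ => Finset.sum_sq_le_sq_sum_of_nonneg fun j _ => hX i j)
  have hD0 : ∀ X : Fin n → Fin m → ℝ, 0 ≤ ∑ i, ((∑ j, X i j) - 1) ^ 2 := fun X =>
    Finset.sum_nonneg fun i _ => sq_nonneg _
  have hE0 : ∀ X : Fin n → Fin m → ℝ, 0 ≤ ∑ j, ((∑ i, a i * X i j) - κ) ^ 2 := fun X =>
    Finset.sum_nonneg fun j _ => sq_nonneg _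
  have hn0 : (0 : ℝ) < n := by exact_mod_cast hn
  refine ⟨fun X hX h0 => ?_, ?_, ?_⟩
  · rw [hP]
    linarith [key X hX h0, hD0 X, hE0 X]
  · rintro ⟨X, hX, h0, hPX⟩
    rw [hP] at hPX
    have hk := key X hX h0
    have hD : ∑ i, ((∑ j, X i j) - 1) ^ 2 = 0 := by linarith [hD0 X, hE0 X]
    have hE : ∑ j, ((∑ i, a i * X i j) - κ) ^ 2 = 0 := by linarith [hE0 X]
    have hrow : ∀ i, ∑ j, X i j = 1 := fun i => by
      have := (Finset.sum_eq_zero_iff_of_nonneg fun i _ => sq_nonneg _).1 hD i (Finset.mem_univ i)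
      exact sub_eq_zero.1 (pow_eq_zero_iff two_ne_zero |>.1 this)
    have hcol : ∀ j, ∑ i, a i * X i j = κ := fun j => by
      have := (Finset.sum_eq_zero_iff_of_nonneg fun j _ => sq_nonneg _).1 hE j (Finset.mem_univ j)
      exact sub_eq_zero.1 (pow_eq_zero_iff two_ne_zero |>.1 this)
    have hS : ∑ i, ∑ j, X i j = n := by simp [hrow]
    have hsq : ∑ i, ∑ j, X i j ^ 2 = n := by
      have hq := sum_sum_sq_pos h0
      have ht : (n : ℝ) / Real.sqrt (∑ i, ∑ j, X i j ^ 2) = Real.sqrt n := by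
        rw [hD, hE, hS] at hPX
        linarith
      rw [div_eq_iff (Real.sqrt_pos.2 hq).ne'] at ht
      have h1 := Real.mul_self_sqrt hn0.le
      have h2 : Real.sqrt n = Real.sqrt (∑ i, ∑ j, X i j ^ 2) :=
        mul_left_cancel₀ (Real.sqrt_pos.2 hn0).ne' (h1.trans ht)
      exact ((Real.sqrt_inj hn0.le hq.le).1 h2).symm
    obtain ⟨f, hf⟩ := exists_eq_ite_of_sum_sq_eq_card hX hrow hsq
    refine ⟨f, fun j => ?_⟩
    rw [← hcol j, Finset.sum_filter]
    simp [hf]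
  · rintro ⟨f, hf⟩
    refine ⟨fun i j => if f i = j then 1 else 0, fun i j => ?_, fun h => ?_, ?_⟩
    · positivity
    · simpa using congrFun (congrFun h ⟨0, hn⟩) (f ⟨0, hn⟩)
    · have hcol : ∀ j, ∑ i, (if f i = j then a i else 0) = κ := fun j => by
        rw [← hf j, Finset.sum_filter]
      rw [hP]
      simp [hcol]
      ring
end

section
/- Let $n \ge 1$, $a \in \mathbb{R}^n$, $p \in (0,1]$ and $q \in (1,+\infty)$. Let $\mathcal{H}$ be the set of pairs $(x, y)$ with $x, y \in \mathbb{R}^n$, $x_i \ge 0$ and $y_i \ge 0$ for all $i$, $\langle a, x\rangle = \langle a, y\rangle$, and $x_i + y_i = 1$ for all $i$. Then: (1) for every $(x,y) \in \mathcal{H}$, $\Big(\sum_i x_i^p + \sum_i y_i^p\Big)^{1/p} \ge n^{1/p - 1/q} \cdot \Big(\sum_i x_i^q + \sum_i y_i^q\Big)^{1/q}$; and (2) there exists $(x,y) \in \mathcal{H}$ for which equality holds if and only if there exists a subset $S \subseteq \{1,\dots,n\}$ with $\sum_{i \in S} a_i = \sum_{i \notin S} a_i$ (an equitable bipartition). 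-/
open Finset in
/-- For `p ≤ 1`, the `p`-th powers of nonnegative pairs with unit sums add up to at least the
number of pairs. -/
theorem card_le_sum_rpow_add_sum_rpow {ι : Type*} [Fintype ι] {x y : ι → ℝ} {p : ℝ}
    (hp1 : p ≤ 1) (hx : ∀ i, 0 ≤ x i) (hy : ∀ i, 0 ≤ y i)
    (hxy : ∀ i, x i + y i = 1) :
    (Fintype.card ι : ℝ) ≤ ∑ i, x i ^ p + ∑ i, y i ^ p := by
  rw [← sum_add_distrib, Fintype.card_eq_sum_ones, Nat.cast_sum]
  refine sum_le_sum fun i _ => ?_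
  have h1 := Real.self_le_rpow_of_le_one (hx i) (by linarith [hxy i, hy i]) hp1
  have h2 := Real.self_le_rpow_of_le_one (hy i) (by linarith [hxy i, hx i]) hp1
  push_cast
  linarith [hxy i]

open Finset in
/-- For `1 ≤ q`, the `q`-th powers of nonnegative pairs with unit sums add up to at most the
number of pairs. -/
theorem sum_rpow_add_sum_rpow_le_card {ι : Type*} [Fintype ι] {x y : ι → ℝ} {q : ℝ}
    (hq : 1 ≤ q) (hx : ∀ i, 0 ≤ x i) (hy : ∀ i, 0 ≤ y i) (hxy : ∀ i, x i + y i = 1) :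
    ∑ i, x i ^ q + ∑ i, y i ^ q ≤ Fintype.card ι := by
  rw [← sum_add_distrib, Fintype.card_eq_sum_ones, Nat.cast_sum]
  refine sum_le_sum fun i _ => ?_
  have h1 := Real.rpow_le_self_of_le_one (hx i) (by linarith [hxy i, hy i]) hq
  have h2 := Real.rpow_le_self_of_le_one (hy i) (by linarith [hxy i, hx i]) hq
  push_cast
  linarith [hxy i]

open Finset in
/-- If the bound `sum_rpow_add_sum_rpow_le_card` is attained for some `q > 1`, every pair is
`(0, 1)` or `(1, 0)`. -/
theorem eq_zero_or_one_of_card_le_sum_rpow {ι : Type*} [Fintype ι] {x y : ι → ℝ} {q : ℝ}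
    (hq : 1 < q) (hx : ∀ i, 0 ≤ x i) (hy : ∀ i, 0 ≤ y i) (hxy : ∀ i, x i + y i = 1)
    (h : (Fintype.card ι : ℝ) ≤ ∑ i, x i ^ q + ∑ i, y i ^ q) (i : ι) :
    x i = 0 ∨ x i = 1 := by
  by_contra! hi
  refine h.not_gt ?_
  rw [← sum_add_distrib, Fintype.card_eq_sum_ones, Nat.cast_sum]
  have le_self (j : ι) : x j ^ q ≤ x j ∧ y j ^ q ≤ y j :=
    ⟨Real.rpow_le_self_of_le_one (hx j) (by linarith [hxy j, hy j]) hq.le,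
      Real.rpow_le_self_of_le_one (hy j) (by linarith [hxy j, hx j]) hq.le⟩
  refine sum_lt_sum (fun j _ => ?_) ⟨i, mem_univ i, ?_⟩
  · push_cast
    linarith [hxy j, le_self j]
  · have hlt := Real.rpow_lt_rpow_of_exponent_gt ((hx i).lt_of_ne' hi.1)
      (lt_of_le_of_ne (by linarith [hxy i, hy i]) hi.2) hq
    rw [Real.rpow_one] at hlt
    push_cast
    linarith [hxy i, le_self i]

theorem partition_reduction_constrained_pq (n : ℕ) (hn : 1 ≤ n) (a : Fin n → ℝ)
    (p q : ℝ) (hp0 : 0 < p) (hp1 : p ≤ 1) (hq : 1 < q) :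
    (∀ x y : Fin n → ℝ, (∀ i, 0 ≤ x i) → (∀ i, 0 ≤ y i) →
      (∑ i, a i * x i) = (∑ i, a i * y i) → (∀ i, x i + y i = 1) →
      (n : ℝ) ^ (1 / p - 1 / q) *
          ((∑ i, (x i) ^ q) + ∑ i, (y i) ^ q) ^ (1 / q) ≤
        ((∑ i, (x i) ^ p) + ∑ i, (y i) ^ p) ^ (1 / p)) ∧
    ((∃ x y : Fin n → ℝ, (∀ i, 0 ≤ x i) ∧ (∀ i, 0 ≤ y i) ∧
        (∑ i, a i * x i) = (∑ i, a i * y i) ∧ (∀ i, x i + y i = 1) ∧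
        ((∑ i, (x i) ^ p) + ∑ i, (y i) ^ p) ^ (1 / p) =
          (n : ℝ) ^ (1 / p - 1 / q) *
            ((∑ i, (x i) ^ q) + ∑ i, (y i) ^ q) ^ (1 / q)) ↔
      ∃ S : Finset (Fin n), ∑ i ∈ S, a i = ∑ i ∈ Sᶜ, a i) := by
  have hn0 : (0 : ℝ) < n := by exact_mod_cast hn
  have hq0 : 0 < q := by linarith
  have factor : (n : ℝ) ^ (1 / p) = (n : ℝ) ^ (1 / p - 1 / q) * (n : ℝ) ^ (1 / q) := by
    rw [← Real.rpow_add hn0, sub_add_cancel]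
  have lower {x y : Fin n → ℝ} (hx : ∀ i, 0 ≤ x i) (hy : ∀ i, 0 ≤ y i)
      (hxy : ∀ i, x i + y i = 1) :
      (n : ℝ) ^ (1 / p - 1 / q) * (n : ℝ) ^ (1 / q) ≤
        ((∑ i, (x i) ^ p) + ∑ i, (y i) ^ p) ^ (1 / p) := by
    rw [← factor]
    refine Real.rpow_le_rpow hn0.le ?_ (by positivity)
    simpa using card_le_sum_rpow_add_sum_rpow hp1 hx hy hxy
  have nonneg {x y : Fin n → ℝ} (hx : ∀ i, 0 ≤ x i) (hy : ∀ i, 0 ≤ y i) :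
      0 ≤ (∑ i, (x i) ^ q) + ∑ i, (y i) ^ q :=
    add_nonneg (Finset.sum_nonneg fun i _ => Real.rpow_nonneg (hx i) q)
      (Finset.sum_nonneg fun i _ => Real.rpow_nonneg (hy i) q)
  refine ⟨fun x y hx hy _ hxy => le_trans ?_ (lower hx hy hxy), ?_, ?_⟩
  · have hle := sum_rpow_add_sum_rpow_le_card hq.le hx hy hxy
    rw [Fintype.card_fin] at hle
    have := nonneg hx hy
    gcongr
  · rintro ⟨x, y, hx, hy, ha, hxy, heq⟩
    have hle : (n : ℝ) ^ (1 / q) ≤ ((∑ i, (x i) ^ q) + ∑ i, (y i) ^ q) ^ (1 / q) :=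
      le_of_mul_le_mul_left ((lower hx hy hxy).trans_eq heq) (by positivity)
    rw [Real.rpow_le_rpow_iff hn0.le (nonneg hx hy) (by positivity)] at hle
    have h01 := eq_zero_or_one_of_card_le_sum_rpow hq hx hy hxy (by simpa using hle)
    refine ⟨Finset.univ.filter fun i => x i = 1, ?_⟩
    rw [Finset.compl_filter, Finset.sum_filter, Finset.sum_filter]
    convert ha using 2 with i _ i _
    · rcases h01 i with h | h <;> simp [h]
    · have := hxy i
      rcases h01 i with h | h
      · have hyi : y i = 1 := by linarith
        simp [h, hyi]
      · have hyi : y i = 0 := by linarith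
        simp [h, hyi]
  · rintro ⟨S, hS⟩
    refine ⟨fun i => if i ∈ S then 1 else 0, fun i => if i ∈ Sᶜ then 1 else 0, ?_, ?_, ?_, ?_, ?_⟩
    · intro i
      dsimp only
      split_ifs <;> norm_num
    · intro i
      dsimp only
      split_ifs <;> norm_num
    · simpa only [mul_ite, mul_one, mul_zero, Finset.sum_ite_mem, Finset.univ_inter] using hS
    · intro i
      by_cases h : i ∈ S <;> simp [h]
    · have sum_eq {s : ℝ} (hs : 0 < s) :
          (∑ i, (if i ∈ S then (1 : ℝ) else 0) ^ s) +
            ∑ i, (if i ∈ Sᶜ then (1 : ℝ) else 0) ^ s = n := by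
        rw [← Finset.sum_add_distrib]
        trans ∑ _i : Fin n, (1 : ℝ)
        · refine Finset.sum_congr rfl fun i _ => ?_
          by_cases h : i ∈ S <;> simp [h, hs.ne']
        · simp
      rw [sum_eq hp0, sum_eq hq0, factor]
end

section
/- Let $n, m \ge 1$, $a \in \mathbb{R}^n$, $\kappa \in \mathbb{R}$, $p \in (0,1]$ and $q \in (1,+\infty)$. Let $\mathcal{H}$ be the set of matrices $X = (X_{ij}) \in \mathbb{R}^{n \times m}$ with $X_{ij} \ge 0$ for all $i,j$, $\sum_{j=1}^m X_{ij} = 1$ for every row $i$, and $\sum_{i=1}^n a_i X_{ij} = \kappa$ for every column $j$. Then: (1) for every $X \in \mathcal{H}$, $\Big(\sum_{i,j} X_{ij}^p\Big)^{1/p} \ge n^{1/p - 1/q} \cdot \Big(\sum_{i,j} X_{ij}^q\Big)^{1/q}$; and (2) there exists $X \in \mathcal{H}$ for which equality holds if and only if there exists a function $f : \{1,\dots,n\} \to \{1,\dots,m\}$ such that $\sum_{i : f(i) = j} a_i = \kappa$ for every $j$ (a partition of the index set into $m$ groups each with sum $\kappa$). -/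
section RowStochastic

variable {ι τ : Type*} [Fintype τ] {X : ι → τ → ℝ}

lemma entry_le_one_of_row_sum_eq_one (h0 : ∀ i j, 0 ≤ X i j) (h1 : ∀ i, ∑ j, X i j = 1)
    (i : ι) (j : τ) : X i j ≤ 1 :=
  h1 i ▸ Finset.single_le_sum (fun j _ => h0 i j) (Finset.mem_univ j)

lemma exists_eq_ite_of_eq_zero_or_eq_one [DecidableEq τ] (h1 : ∀ i, ∑ j, X i j = 1)
    (h01 : ∀ i j, X i j = 0 ∨ X i j = 1) :
    ∃ f : ι → τ, ∀ i j, X i j = if f i = j then 1 else 0 := by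
  have hex : ∀ i, ∃ j, X i j = 1 := by
    intro i
    by_contra! hne
    have := h1 i
    simp [fun j => (h01 i j).resolve_right (hne j)] at this
  choose f hf using hex
  refine ⟨f, fun i j => ?_⟩
  split_ifs with hij
  · rw [← hij, hf]
  · have hrest : ∑ j ∈ Finset.univ.erase (f i), X i j = 0 := by
      have := Finset.add_sum_erase Finset.univ (X i) (Finset.mem_univ (f i))
      rw [h1, hf] at this
      linarith
    refine (Finset.sum_eq_zero_iff_of_nonneg fun j _ => ?_).1 hrest j (by simp [Ne.symm hij])
    rcases h01 i j with h | h <;> simp [h]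

variable [Fintype ι]

lemma sum_sum_eq_card_of_row_sum_eq_one (h1 : ∀ i, ∑ j, X i j = 1) :
    ∑ i, ∑ j, X i j = Fintype.card ι := by
  simp [h1]

lemma card_le_sum_sum_rpow (h0 : ∀ i j, 0 ≤ X i j) (h1 : ∀ i, ∑ j, X i j = 1) {p : ℝ}
    (hp1 : p ≤ 1) : (Fintype.card ι : ℝ) ≤ ∑ i, ∑ j, X i j ^ p := by
  rw [← sum_sum_eq_card_of_row_sum_eq_one h1]
  exact Finset.sum_le_sum fun i _ => Finset.sum_le_sum fun j _ =>
    Real.self_le_rpow_of_le_one (h0 i j) (entry_le_one_of_row_sum_eq_one h0 h1 i j) hp1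

lemma sum_sum_rpow_le_card (h0 : ∀ i j, 0 ≤ X i j) (h1 : ∀ i, ∑ j, X i j = 1) {q : ℝ}
    (hq : 1 ≤ q) : ∑ i, ∑ j, X i j ^ q ≤ Fintype.card ι := by
  rw [← sum_sum_eq_card_of_row_sum_eq_one h1]
  exact Finset.sum_le_sum fun i _ => Finset.sum_le_sum fun j _ =>
    Real.rpow_le_self_of_le_one (h0 i j) (entry_le_one_of_row_sum_eq_one h0 h1 i j) hq

lemma eq_zero_or_eq_one_of_card_le_sum_sum_rpow (h0 : ∀ i j, 0 ≤ X i j)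
    (h1 : ∀ i, ∑ j, X i j = 1) {q : ℝ} (hq : 1 < q)
    (h : (Fintype.card ι : ℝ) ≤ ∑ i, ∑ j, X i j ^ q) (i : ι) (j : τ) :
    X i j = 0 ∨ X i j = 1 := by
  by_contra! hne
  have hle := fun i j =>
    Real.rpow_le_self_of_le_one (h0 i j) (entry_le_one_of_row_sum_eq_one h0 h1 i j) hq.le
  have hlt : X i j ^ q < X i j :=
    Real.rpow_lt_self_of_lt_one ((h0 i j).lt_of_ne' hne.1)
      ((entry_le_one_of_row_sum_eq_one h0 h1 i j).lt_of_ne hne.2) hq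
  have hsum : ∑ i, ∑ j, X i j ^ q < ∑ i, ∑ j, X i j :=
    Finset.sum_lt_sum (fun i _ => Finset.sum_le_sum fun j _ => hle i j)
      ⟨i, Finset.mem_univ i, Finset.sum_lt_sum (fun j _ => hle i j) ⟨j, Finset.mem_univ j, hlt⟩⟩
  rw [sum_sum_eq_card_of_row_sum_eq_one h1] at hsum
  exact hsum.not_ge h

end RowStochastic

lemma rpow_one_div_sub_mul_rpow_one_div {x : ℝ} (hx : 0 < x) (p q : ℝ) :
    x ^ (1 / p - 1 / q) * x ^ (1 / q) = x ^ (1 / p) := by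
  rw [← Real.rpow_add hx, sub_add_cancel]


theorem three_partition_reduction_constrained_pq (n m : ℕ) (hn : 1 ≤ n) (hm : 1 ≤ m)
    (a : Fin n → ℝ) (κ : ℝ) (p q : ℝ) (hp0 : 0 < p) (hp1 : p ≤ 1) (hq : 1 < q) :
    (∀ X : Fin n → Fin m → ℝ, (∀ i j, 0 ≤ X i j) →
      (∀ i, ∑ j, X i j = 1) → (∀ j, ∑ i, a i * X i j = κ) →
      (n : ℝ) ^ (1 / p - 1 / q) * (∑ i, ∑ j, (X i j) ^ q) ^ (1 / q) ≤
        (∑ i, ∑ j, (X i j) ^ p) ^ (1 / p)) ∧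
    ((∃ X : Fin n → Fin m → ℝ, (∀ i j, 0 ≤ X i j) ∧
        (∀ i, ∑ j, X i j = 1) ∧ (∀ j, ∑ i, a i * X i j = κ) ∧
        (∑ i, ∑ j, (X i j) ^ p) ^ (1 / p) =
          (n : ℝ) ^ (1 / p - 1 / q) * (∑ i, ∑ j, (X i j) ^ q) ^ (1 / q)) ↔
      ∃ f : Fin n → Fin m, ∀ j, ∑ i ∈ Finset.univ.filter (fun i => f i = j), a i = κ) := by
  have hn0 : (0 : ℝ) < n := by exact_mod_cast hn
  have hq0 : 0 < q := by linarith
  have lower : ∀ X : Fin n → Fin m → ℝ, (∀ i j, 0 ≤ X i j) → (∀ i, ∑ j, X i j = 1) →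
      (n : ℝ) ^ (1 / p) ≤ (∑ i, ∑ j, (X i j) ^ p) ^ (1 / p) := fun X h0 h1 =>
    Real.rpow_le_rpow hn0.le (by simpa using card_le_sum_sum_rpow h0 h1 hp1) (by positivity)
  have nonneg : ∀ X : Fin n → Fin m → ℝ, (∀ i j, 0 ≤ X i j) →
      0 ≤ ∑ i, ∑ j, (X i j) ^ q := fun X h0 =>
    Finset.sum_nonneg fun i _ => Finset.sum_nonneg fun j _ => Real.rpow_nonneg (h0 i j) q
  refine ⟨fun X h0 h1 _ => ?_, ?_, ?_⟩
  · refine le_trans ?_ (lower X h0 h1)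
    rw [← rpow_one_div_sub_mul_rpow_one_div hn0 p q]
    gcongr
    · exact nonneg X h0
    · simpa using sum_sum_rpow_le_card h0 h1 hq.le
  · rintro ⟨X, h0, h1, hκ, heq⟩
    have hle := lower X h0 h1
    rw [heq, ← rpow_one_div_sub_mul_rpow_one_div hn0 p q] at hle
    have hcard : (n : ℝ) ≤ ∑ i, ∑ j, (X i j) ^ q :=
      (Real.rpow_le_rpow_iff hn0.le (nonneg X h0) (by positivity)).1
        (le_of_mul_le_mul_left hle (by positivity))
    obtain ⟨f, hf⟩ := exists_eq_ite_of_eq_zero_or_eq_one h1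
      (eq_zero_or_eq_one_of_card_le_sum_sum_rpow h0 h1 hq (by simpa using hcard))
    refine ⟨f, fun j => ?_⟩
    rw [← hκ j, Finset.sum_filter]
    simp [hf]
  · rintro ⟨f, hf⟩
    have hpow : ∀ s : ℝ, 0 < s →
        ∑ i, ∑ j, (if f i = j then (1 : ℝ) else 0) ^ s = n := fun s hs => by
      simp [apply_ite (fun x : ℝ => x ^ s), Real.zero_rpow hs.ne']
    refine ⟨fun i j => if f i = j then 1 else 0, fun i j => ?_, fun i => by simp, fun j => ?_, ?_⟩
    · dsimp only
      split_ifs <;> simp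
    · rw [← hf j, Finset.sum_filter]
      simp
    · rw [hpow p hp0, hpow q hq0, rpow_one_div_sub_mul_rpow_one_div hn0]
end
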